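/- arXiv:nlin/0312042 — 2 statements merged into one kernel-verified Lean document; each statement's English description precedes it below -/
import Mathlib

section
/- Fix Γ > 0 and K > 0. For every velocity v > 1/Γ there exists exactly one solution u of equation (wff) with parameter λ = 1/v; consequently there is exactly one force F (namely F = Γv + (1/(2π)) ∫₀^{2π} sin(s + u(s)) ds) for which the discrete sine-Gordon ring has a travelling wave with velocity v whose profile u has zero mean on [0, 2π]. -/
open Real in
/-- `u` is a solution of equation (wff) with parameter `λ = lam`: a `C²`,
`2π`-periodic function with zero mean on `[0, 2π]` satisfying
`u'' + λΓu' + λ²sin(z+u) = λ²·(1/2π)∫₀^{2π} sin(s+u(s)) ds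
 + λ²K[u(z+2πm/n) − 2u(z) + u(z−2πm/n)]`. -/
def WffSolution (n m : ℕ) (Γ K lam : ℝ) (u : ℝ → ℝ) : Prop :=
  ContDiff ℝ 2 u ∧
  (∀ z : ℝ, u (z + 2 * π) = u z) ∧
  (∫ s in (0:ℝ)..(2 * π), u s) = 0 ∧
  (∀ z : ℝ, deriv (deriv u) z + lam * Γ * deriv u z + lam ^ 2 * Real.sin (z + u z)
      = lam ^ 2 * (1 / (2 * π)) * (∫ s in (0:ℝ)..(2 * π), Real.sin (s + u s))
        + lam ^ 2 * K * (u (z + 2 * π * m / n) - 2 * u z + u (z - 2 * π * m / n)))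

section FourierMultiplier

open MeasureTheory AddCircle
open scoped NNReal ENNReal

variable {T : ℝ} [hT : Fact (0 < T)]

theorem exists_lp_fourierCoeff_eq_mul {m : ℤ → ℂ} {q : ℝ} (hm : ∀ k, ‖m k‖ ≤ q)
    (f : Lp ℂ 2 (@haarAddCircle T hT)) :
    ∃ g : Lp ℂ 2 (@haarAddCircle T hT), ∀ k, fourierCoeff g k = m k * fourierCoeff f k := by
  have hmem : Memℓp (fun k => m k * fourierBasis.repr f k) 2 := by
    refine memℓp_gen (Summable.of_nonneg_of_le (fun k => by positivity) (fun k => ?_)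
      (((lp.memℓp (fourierBasis.repr f)).summable (by simp)).mul_left (q ^ (2 : ℝ))))
    have hq : 0 ≤ q := (norm_nonneg _).trans (hm k)
    simp only [ENNReal.toReal_ofNat]
    rw [← Real.mul_rpow hq (norm_nonneg _), norm_mul]
    gcongr
    exact hm k
  refine ⟨fourierBasis.repr.symm ⟨_, hmem⟩, fun k => ?_⟩
  rw [← fourierBasis_repr, ← fourierBasis_repr, LinearIsometryEquiv.apply_symm_apply]

theorem Lp_eq_of_fourierCoeff_eq {f g : Lp ℂ 2 (@haarAddCircle T hT)}
    (h : ∀ k, fourierCoeff f k = fourierCoeff g k) : f = g :=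
  (hasSum_fourier_series_L2 f).unique (by simpa only [h] using hasSum_fourier_series_L2 g)

theorem norm_le_mul_of_norm_fourierCoeff_le {q : ℝ} (hq : 0 ≤ q)
    {f g : Lp ℂ 2 (@haarAddCircle T hT)}
    (h : ∀ k, ‖fourierCoeff f k‖ ≤ q * ‖fourierCoeff g k‖) : ‖f‖ ≤ q * ‖g‖ := by
  have : ‖fourierBasis.repr f‖ ≤ ‖(q : ℂ) • fourierBasis.repr g‖ := by
    refine lp.norm_mono (by simp) fun k => ?_
    rw [lp.coeFn_smul, Pi.smul_apply, fourierBasis_repr, fourierBasis_repr, norm_smul,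
      Complex.norm_real, Real.norm_of_nonneg hq]
    exact h k
  rwa [norm_smul, LinearIsometryEquiv.norm_map, LinearIsometryEquiv.norm_map, Complex.norm_real,
    Real.norm_of_nonneg hq] at this

theorem norm_fourierCoeff_le (f : Lp ℂ 2 (@haarAddCircle T hT)) (k : ℤ) :
    ‖fourierCoeff f k‖ ≤ ‖f‖ := by
  rw [← fourierBasis_repr, ← fourierBasis.repr.norm_map f]
  exact lp.norm_apply_le_norm (by simp) _ k

theorem memLp_comp_of_lipschitz {G : AddCircle T → ℂ → ℂ}
    (hG : Continuous (Function.uncurry G)) (hL : ∀ z x y, ‖G z x - G z y‖ ≤ ‖x - y‖)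
    (U : Lp ℂ 2 (@haarAddCircle T hT)) : MemLp (fun z => G z (U z)) 2 (@haarAddCircle T hT) := by
  have h0 : MemLp (fun z => G z 0) 2 (@haarAddCircle T hT) := by
    have hc : Continuous fun z => G z 0 := hG.comp (by fun_prop : Continuous fun z => (z, (0 : ℂ)))
    exact hc.memLp_of_hasCompactSupport (HasCompactSupport.of_compactSpace _)
  have hms : AEStronglyMeasurable (fun z => G z (U z)) (@haarAddCircle T hT) :=
    hG.comp_aestronglyMeasurable
      (aestronglyMeasurable_id.prodMk (Lp.memLp U).aestronglyMeasurable)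
  have h1 : MemLp (fun z => G z (U z) - G z 0) 2 (@haarAddCircle T hT) :=
    (Lp.memLp U).of_le (hms.sub h0.aestronglyMeasurable)
      (Filter.Eventually.of_forall fun z => by simpa using hL z (U z) 0)
  convert h1.add h0 using 1
  ext z
  simp

theorem existsUnique_lp_fourierCoeff_eq {m : ℤ → ℂ} {q : ℝ≥0} (hq : q < 1)
    (hm : ∀ k, ‖m k‖ ≤ q) {G : AddCircle T → ℂ → ℂ}
    (hG : Continuous (Function.uncurry G)) (hL : ∀ z x y, ‖G z x - G z y‖ ≤ ‖x - y‖) :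
    ∃! U : Lp ℂ 2 (@haarAddCircle T hT),
      ∀ k, fourierCoeff U k = m k * fourierCoeff (fun z => G z (U z)) k := by
  let N (U : Lp ℂ 2 (@haarAddCircle T hT)) : Lp ℂ 2 (@haarAddCircle T hT) :=
    (memLp_comp_of_lipschitz hG hL U).toLp
  have hN (U) : fourierCoeff (N U) = fourierCoeff (fun z => G z (U z)) :=
    fourierCoeff_congr_ae (MemLp.coeFn_toLp _)
  have hNL (U V) : ‖N U - N V‖ ≤ ‖U - V‖ := by
    refine Lp.norm_le_norm_of_ae_le ?_
    filter_upwards [Lp.coeFn_sub (N U) (N V), Lp.coeFn_sub U V,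
      (memLp_comp_of_lipschitz hG hL U).coeFn_toLp,
      (memLp_comp_of_lipschitz hG hL V).coeFn_toLp] with z h1 h2 h3 h4
    rw [h1, h2, Pi.sub_apply, Pi.sub_apply, h3, h4]
    exact hL z _ _
  choose J hJ using fun f => exists_lp_fourierCoeff_eq_mul (T := T) hm f
  have hsub (f g : Lp ℂ 2 (@haarAddCircle T hT)) (k : ℤ) :
      fourierCoeff (f - g : Lp ℂ 2 (@haarAddCircle T hT)) k
        = fourierCoeff f k - fourierCoeff g k := by
    simp only [← fourierBasis_repr, map_sub, lp.coeFn_sub, Pi.sub_apply]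
  have hJL (f g) : ‖J f - J g‖ ≤ q * ‖f - g‖ := by
    refine norm_le_mul_of_norm_fourierCoeff_le q.2 fun k => ?_
    rw [hsub, hsub, hJ, hJ, ← mul_sub, norm_mul]
    gcongr
    exact hm k
  have hC : ContractingWith q (fun U => J (N U)) := by
    refine ⟨hq, LipschitzWith.of_dist_le_mul fun U V => ?_⟩
    rw [dist_eq_norm, dist_eq_norm]
    exact (hJL _ _).trans (by gcongr; exact hNL U V)
  have hiff (U : Lp ℂ 2 (@haarAddCircle T hT)) : (∀ k, fourierCoeff U k = m k * fourierCoeff (fun z => G z (U z)) k) ↔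
      Function.IsFixedPt (fun U => J (N U)) U := by
    refine ⟨fun h => Lp_eq_of_fourierCoeff_eq fun k => ?_, fun h k => ?_⟩
    · rw [hJ, hN, h k]
    · conv_lhs => rw [← h.eq]
      rw [hJ, hN]
  refine ⟨hC.fixedPoint, (hiff _).2 hC.fixedPoint_isFixedPt, fun V hV => ?_⟩
  exact hC.fixedPoint_unique ((hiff V).1 hV)

theorem existsUnique_continuousMap_fourierCoeff_eq {m : ℤ → ℂ} {q : ℝ≥0} (hq : q < 1)
    (hm : ∀ k, ‖m k‖ ≤ q) (hs : Summable fun k => ‖m k‖) {G : AddCircle T → ℂ → ℂ}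
    (hG : Continuous (Function.uncurry G)) (hL : ∀ z x y, ‖G z x - G z y‖ ≤ ‖x - y‖) :
    ∃! u : C(AddCircle T, ℂ),
      ∀ k, fourierCoeff u k = m k * fourierCoeff (fun z => G z (u z)) k := by
  obtain ⟨U, hU, hU'⟩ := existsUnique_lp_fourierCoeff_eq (T := T) hq hm hG hL
  have hcongr (u : C(AddCircle T, ℂ)) :
      fourierCoeff (fun z => G z (ContinuousMap.toLp (E := ℂ) 2 haarAddCircle ℂ u z))
        = fourierCoeff (fun z => G z (u z)) := by
    refine fourierCoeff_congr_ae ?_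
    filter_upwards [ContinuousMap.coeFn_toLp (p := 2) (𝕜 := ℂ) (@haarAddCircle T hT) u] with z hz
    rw [hz]
  have hsum : Summable fun k => fourierCoeff U k • @fourier T k := by
    refine Summable.of_norm_bounded
      (hs.mul_right ‖(memLp_comp_of_lipschitz hG hL U).toLp‖) fun k => ?_
    rw [norm_smul, fourier_norm, mul_one, hU k, norm_mul,
      ← fourierCoeff_congr_ae (memLp_comp_of_lipschitz hG hL U).coeFn_toLp]
    gcongr
    exact norm_fourierCoeff_le _ k
  obtain ⟨u, hu⟩ := hsum
  have huU : ContinuousMap.toLp (E := ℂ) 2 haarAddCircle ℂ u = U := by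
    refine HasSum.unique ?_ (hasSum_fourier_series_L2 U)
    simpa [Function.comp_def, fourierLp] using
      (ContinuousMap.toLp (E := ℂ) 2 (@haarAddCircle T hT) ℂ).hasSum hu
  refine ⟨u, fun k => ?_, fun w hw => ?_⟩
  · rw [← hcongr u, ← fourierCoeff_toLp, huU, hU k]
  · refine ContinuousMap.toLp_injective (p := 2) (𝕜 := ℂ) (@haarAddCircle T hT) ?_
    rw [huU]
    refine hU' _ fun k => ?_
    simp only [hcongr w, fourierCoeff_toLp, hw k]

end FourierMultiplier

section PeriodicCoeff

open MeasureTheory AddCircle Complex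

/-- The `k`-th Fourier coefficient of `f` over `[0, 2π]`, without the factor `1 / (2π)`. -/
noncomputable def periodicCoeff (f : ℝ → ℂ) (k : ℤ) : ℂ :=
  ∫ t in (0 : ℝ)..(2 * Real.pi), exp (-(k * t * I)) * f t

theorem continuous_exp_neg_int_mul (k : ℤ) : Continuous fun t : ℝ => exp (-(k * t * I)) := by
  fun_prop

theorem intervalIntegrable_exp_mul {f : ℝ → ℂ} (hf : Continuous f) (k : ℤ) (a b : ℝ) :
    IntervalIntegrable (fun t : ℝ => exp (-(k * t * I)) * f t) volume a b :=
  ((continuous_exp_neg_int_mul k).mul hf).intervalIntegrable _ _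

theorem periodicCoeff_zero_right (f : ℝ → ℂ) :
    periodicCoeff f 0 = ∫ t in (0 : ℝ)..(2 * Real.pi), f t := by
  simp [periodicCoeff]

theorem periodicCoeff_add {f g : ℝ → ℂ} (hf : Continuous f) (hg : Continuous g) (k : ℤ) :
    periodicCoeff (fun t => f t + g t) k = periodicCoeff f k + periodicCoeff g k := by
  simp only [periodicCoeff, mul_add]
  exact intervalIntegral.integral_add (intervalIntegrable_exp_mul hf k _ _)
    (intervalIntegrable_exp_mul hg k _ _)

theorem periodicCoeff_sub {f g : ℝ → ℂ} (hf : Continuous f) (hg : Continuous g) (k : ℤ) :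
    periodicCoeff (fun t => f t - g t) k = periodicCoeff f k - periodicCoeff g k := by
  simp only [periodicCoeff, mul_sub]
  exact intervalIntegral.integral_sub (intervalIntegrable_exp_mul hf k _ _)
    (intervalIntegrable_exp_mul hg k _ _)

theorem periodicCoeff_const_mul (c : ℂ) (f : ℝ → ℂ) (k : ℤ) :
    periodicCoeff (fun t => c * f t) k = c * periodicCoeff f k := by
  simp only [periodicCoeff, ← intervalIntegral.integral_const_mul]
  congr 1
  ext t
  ring

theorem exp_neg_int_mul_two_pi (k : ℤ) : exp (-(k * ((2 * Real.pi : ℝ) : ℂ) * I)) = 1 := by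
  rw [exp_eq_one_iff]
  exact ⟨-k, by push_cast; ring⟩

theorem periodicCoeff_deriv {f f' : ℝ → ℂ} (hf : ∀ z, HasDerivAt f (f' z) z)
    (hf' : Continuous f') (hp : Function.Periodic f (2 * Real.pi)) (k : ℤ) :
    periodicCoeff f' k = k * I * periodicCoeff f k := by
  have he (t : ℝ) : HasDerivAt (fun t : ℝ => exp (-(k * t * I)))
      (-(k * I) * exp (-(k * t * I))) t := by
    have h := ((ofRealCLM.hasDerivAt (x := t)).const_mul (-(k * I))).cexp
    have hlin (s : ℝ) : -(k * s * I) = -(k * I) * ofRealCLM s := by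
      rw [ofRealCLM_apply]
      ring
    simp only [hlin]
    convert h using 1
    simp [mul_comm]
  have hE : Continuous fun t : ℝ => -(k * I) * exp (-(k * t * I)) := by fun_prop
  rw [periodicCoeff, intervalIntegral.integral_mul_deriv_eq_deriv_mul (fun t _ => he t)
    (fun t _ => hf t) (hE.intervalIntegrable _ _) (hf'.intervalIntegrable _ _),
    exp_neg_int_mul_two_pi, show f (2 * Real.pi) = f 0 by simpa using hp 0, periodicCoeff,
    ← intervalIntegral.integral_const_mul]
  simp [mul_assoc]

theorem periodicCoeff_const (c : ℂ) {k : ℤ} (hk : k ≠ 0) : periodicCoeff (fun _ => c) k = 0 := by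
  have h := periodicCoeff_deriv (f := fun _ => c) (f' := fun _ => 0)
    (fun z => hasDerivAt_const z c) continuous_const (fun _ => rfl) k
  simpa [periodicCoeff, hk] using h.symm

theorem periodicCoeff_shift {f : ℝ → ℂ} (hp : Function.Periodic f (2 * Real.pi)) (a : ℝ) (k : ℤ) :
    periodicCoeff (fun t => f (t + a)) k = exp (k * a * I) * periodicCoeff f k := by
  have hper : Function.Periodic (fun t : ℝ => exp (-(k * t * I)) * f t) (2 * Real.pi) := by
    intro t
    simp only [hp t, ofReal_add, mul_add, add_mul, neg_add, exp_add, exp_neg_int_mul_two_pi,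
      mul_one]
  have h1 := intervalIntegral.integral_comp_add_right (a := 0) (b := 2 * Real.pi)
    (fun t : ℝ => exp (-(k * t * I)) * f t) a
  have h2 := hper.intervalIntegral_add_eq a 0
  rw [zero_add, add_comm (2 * Real.pi) a, h2, zero_add] at h1
  rw [periodicCoeff, periodicCoeff, ← h1, ← intervalIntegral.integral_const_mul]
  congr 1
  ext t
  rw [← mul_assoc, ← exp_add]
  congr 2
  push_cast
  ring

theorem exists_periodic_primitive {h : ℝ → ℂ} (hc : Continuous h)
    (hp : Function.Periodic h (2 * Real.pi)) (h0 : periodicCoeff h 0 = 0) :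
    ∃ P : ℝ → ℂ, (∀ z, HasDerivAt P (h z) z) ∧ Function.Periodic P (2 * Real.pi) ∧
      periodicCoeff P 0 = 0 := by
  rw [periodicCoeff_zero_right] at h0
  let Q (z : ℝ) : ℂ := ∫ t in (0 : ℝ)..z, h t
  have hQ (z : ℝ) : HasDerivAt Q (h z) z :=
    intervalIntegral.integral_hasDerivAt_right (hc.intervalIntegrable _ _)
      (hc.stronglyMeasurableAtFilter _ _) hc.continuousAt
  have hQc : Continuous Q := continuous_iff_continuousAt.2 fun z => (hQ z).continuousAt
  have hQp : Function.Periodic Q (2 * Real.pi) := by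
    intro z
    have h1 := intervalIntegral.integral_add_adjacent_intervals
      (hc.intervalIntegrable 0 z) (hc.intervalIntegrable z (z + 2 * Real.pi))
        (μ := volume)
    rw [hp.intervalIntegral_add_eq z 0, zero_add, h0, add_zero] at h1
    exact h1.symm
  refine ⟨fun z => Q z - (2 * Real.pi : ℂ)⁻¹ * periodicCoeff Q 0,
    fun z => (hQ z).sub_const _, fun z => by simp only [hQp z], ?_⟩
  have hpi : (Real.pi : ℂ) ≠ 0 := by exact_mod_cast Real.pi_ne_zero
  have hconst (c : ℂ) : periodicCoeff (fun _ => c) 0 = 2 * Real.pi * c := by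
    simp [periodicCoeff_zero_right]
  rw [periodicCoeff_sub hQc continuous_const, hconst]
  field_simp
  simp

theorem fourierCoeff_eq_periodicCoeff [Fact (0 < 2 * Real.pi)]
    (f : AddCircle (2 * Real.pi) → ℂ) (k : ℤ) :
    fourierCoeff f k = (2 * Real.pi : ℂ)⁻¹ * periodicCoeff (fun t : ℝ => f t) k := by
  rw [fourierCoeff_eq_intervalIntegral f k 0, zero_add, periodicCoeff, real_smul]
  have : (Real.pi : ℂ) ≠ 0 := by exact_mod_cast Real.pi_ne_zero
  congr 1
  · push_cast
    rw [one_div]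
  · congr 1
    ext t
    rw [fourier_coe_apply, smul_eq_mul]
    congr 2
    push_cast
    field_simp

theorem exists_continuousMap_eq {f : ℝ → ℂ} (hf : Continuous f)
    (hp : Function.Periodic f (2 * Real.pi)) :
    ∃ F : C(AddCircle (2 * Real.pi), ℂ), ∀ t : ℝ, F t = f t :=
  ⟨⟨hp.lift, hf.quotient_lift _⟩, fun t => hp.lift_coe t⟩

theorem eq_of_periodicCoeff_eq {f g : ℝ → ℂ} (hf : Continuous f) (hg : Continuous g)
    (hfp : Function.Periodic f (2 * Real.pi)) (hgp : Function.Periodic g (2 * Real.pi))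
    (h : ∀ k, periodicCoeff f k = periodicCoeff g k) : f = g := by
  have : Fact (0 < 2 * Real.pi) := ⟨Real.two_pi_pos⟩
  obtain ⟨F, hF⟩ := exists_continuousMap_eq hf hfp
  obtain ⟨G, hG⟩ := exists_continuousMap_eq hg hgp
  have hFG : F = G := by
    refine ContinuousMap.toLp_injective (p := 2) (𝕜 := ℂ) haarAddCircle ?_
    refine (hasSum_fourier_series_L2 _).unique ?_
    convert hasSum_fourier_series_L2 (ContinuousMap.toLp (E := ℂ) 2 haarAddCircle ℂ G) using 3
    rw [fourierCoeff_toLp, fourierCoeff_toLp, fourierCoeff_eq_periodicCoeff,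
      fourierCoeff_eq_periodicCoeff]
    simp only [hF, hG, h]
  ext t
  rw [← hF, ← hG, hFG]

theorem hasDerivAt_of_periodicCoeff {u h : ℝ → ℂ} {a : ℂ} (hu : Continuous u) (hh : Continuous h)
    (hup : Function.Periodic u (2 * Real.pi)) (hhp : Function.Periodic h (2 * Real.pi))
    (hu0 : periodicCoeff u 0 = 0)
    (heq : ∀ k : ℤ, ((k * I) ^ 2 + a * (k * I)) * periodicCoeff u k = periodicCoeff h k) :
    ∃ u' : ℝ → ℂ, (∀ z, HasDerivAt u (u' z) z) ∧ ∀ z, HasDerivAt u' (h z - a * u' z) z := by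
  have hh0 : periodicCoeff h 0 = 0 := by simpa using (heq 0).symm
  obtain ⟨P, hP, hPp, hP0⟩ := exists_periodic_primitive hh hhp hh0
  have hPc : Continuous P := continuous_iff_continuousAt.2 fun z => (hP z).continuousAt
  have hau : Continuous fun t => a * u t := hu.const_mul a
  obtain ⟨w, hw, hwp, hw0⟩ := exists_periodic_primitive (h := fun t => P t - a * u t)
    (hPc.sub hau) (fun t => by simp only [hPp t, hup t])
    (by rw [periodicCoeff_sub hPc hau, periodicCoeff_const_mul, hP0, hu0]; simp)
  have hwc : Continuous w := continuous_iff_continuousAt.2 fun z => (hw z).continuousAt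
  have hwu : w = u := by
    refine eq_of_periodicCoeff_eq hwc hu hwp hup fun k => ?_
    rcases eq_or_ne k 0 with rfl | hk
    · rw [hw0, hu0]
    have h1 := periodicCoeff_deriv hw (hPc.sub hau) hwp k
    rw [periodicCoeff_sub hPc hau, periodicCoeff_const_mul] at h1
    have h2 := periodicCoeff_deriv hP hh hPp k
    have hkI : (k : ℂ) * I ≠ 0 := by simp [hk]
    have h3 := heq k
    apply mul_left_cancel₀ hkI
    apply mul_left_cancel₀ hkI
    linear_combination (-(k : ℂ) * I) * h1 - h2 - h3
  subst hwu
  exact ⟨_, hw, fun z => (hP z).sub ((hw z).const_mul a)⟩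

end PeriodicCoeff

section WffSymbol

open Complex

/-- The Fourier symbol of `u ↦ u'' + a u' - c (u(· + θ) - 2 u + u(· - θ))`. -/
noncomputable def wffSymbol (a c θ : ℝ) (k : ℤ) : ℂ :=
  (k * I) ^ 2 + a * (k * I) - c * (exp (k * θ * I) - 2 + exp (k * (-θ : ℝ) * I))

theorem wffSymbol_eq (a c θ : ℝ) (k : ℤ) :
    wffSymbol a c θ k = ((-k ^ 2 + c * (2 - 2 * Real.cos (k * θ)) : ℝ) : ℂ) + (a * k : ℝ) * I := by
  have h := two_cos (k * θ : ℂ)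
  have h2 : exp (k * (-θ : ℝ) * I) = exp (-(k * θ) * I) := by
    congr 1
    push_cast
    ring
  rw [wffSymbol, h2]
  push_cast
  linear_combination (k : ℂ) ^ 2 * I_sq + (c : ℂ) * h

theorem wffSymbol_zero (a c θ : ℝ) : wffSymbol a c θ 0 = 0 := by
  simp [wffSymbol_eq]

theorem mul_abs_le_norm_wffSymbol {a : ℝ} (ha : 0 < a) (c θ : ℝ) (k : ℤ) :
    a * |(k : ℝ)| ≤ ‖wffSymbol a c θ k‖ := by
  refine le_trans (le_of_eq ?_) (abs_im_le_norm _)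
  rw [wffSymbol_eq, add_im, ofReal_im, im_ofReal_mul, I_im, mul_one, zero_add, abs_mul,
    abs_of_pos ha]

theorem le_norm_wffSymbol {a : ℝ} (ha : 0 < a) (c θ : ℝ) {k : ℤ} (hk : k ≠ 0) :
    a ≤ ‖wffSymbol a c θ k‖ := by
  have h1 : (1 : ℝ) ≤ |(k : ℝ)| := by exact_mod_cast Int.one_le_abs hk
  nlinarith [mul_abs_le_norm_wffSymbol ha c θ k]

theorem sq_le_mul_norm_wffSymbol {a c : ℝ} (ha : 0 < a) (hc : 0 ≤ c) (θ : ℝ) {k : ℤ}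
    (hk : k ≠ 0) : (k : ℝ) ^ 2 ≤ (1 + 4 * c / a) * ‖wffSymbol a c θ k‖ := by
  have h1 := neg_le_of_abs_le (abs_re_le_norm (wffSymbol a c θ k))
  rw [wffSymbol_eq, add_re, ofReal_re, re_ofReal_mul, I_re, mul_zero, add_zero,
    ← wffSymbol_eq] at h1
  have h2 : c * (2 - 2 * Real.cos (k * θ)) ≤ 4 * c := by
    nlinarith [Real.neg_one_le_cos (k * θ)]
  have h3 : 4 * c ≤ 4 * c / a * ‖wffSymbol a c θ k‖ := by
    rw [div_mul_eq_mul_div, le_div_iff₀ ha]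
    gcongr
    exact le_norm_wffSymbol ha c θ hk
  linarith

theorem norm_div_wffSymbol_le {a b : ℝ} (ha : 0 < a) (hb : 0 ≤ b) (c θ : ℝ) (k : ℤ) :
    ‖-(b : ℂ) / wffSymbol a c θ k‖ ≤ b / a := by
  rcases eq_or_ne k 0 with rfl | hk
  · simpa [wffSymbol_zero] using div_nonneg hb ha.le
  rw [norm_div, norm_neg, norm_real, Real.norm_of_nonneg hb]
  gcongr
  exact le_norm_wffSymbol ha c θ hk

theorem summable_norm_div_wffSymbol {a b c : ℝ} (ha : 0 < a) (hb : 0 ≤ b) (hc : 0 ≤ c) (θ : ℝ) :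
    Summable fun k => ‖-(b : ℂ) / wffSymbol a c θ k‖ := by
  refine Summable.of_nonneg_of_le (fun k => norm_nonneg _) (fun k => ?_)
    ((Real.summable_one_div_int_pow.2 one_lt_two).mul_left (b * (1 + 4 * c / a)))
  rcases eq_or_ne k 0 with rfl | hk
  · simp [wffSymbol_zero]
  have hk2 : 0 < (k : ℝ) ^ 2 := by positivity
  rw [norm_div, norm_neg, norm_real, Real.norm_of_nonneg hb, mul_one_div,
    div_le_div_iff₀ (ha.trans_le (le_norm_wffSymbol ha c θ hk)) hk2, mul_assoc]
  gcongr
  exact sq_le_mul_norm_wffSymbol ha hc θ hk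

theorem periodic_of_hasDerivAt {f f' : ℝ → ℂ} {T : ℝ} (hf : ∀ z, HasDerivAt f (f' z) z)
    (hp : Function.Periodic f T) : Function.Periodic f' T := fun z => by
  have h := (hf (z + T)).comp_add_const z T
  simp only [hp _] at h
  exact h.unique (hf z)

theorem periodicCoeff_shift_combination {p : ℝ → ℂ} (hpc : Continuous p)
    (hp : Function.Periodic p (2 * Real.pi)) (θ : ℝ) (k : ℤ) :
    periodicCoeff (fun z => p (z + θ) - 2 * p z + p (z - θ)) k
      = (exp (k * θ * I) - 2 + exp (k * (-θ : ℝ) * I)) * periodicCoeff p k := by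
  have h1 : Continuous fun z => p (z + θ) := by fun_prop
  have h2 : Continuous fun z => 2 * p z := by fun_prop
  have h3 : Continuous fun z => p (z + -θ) := by fun_prop
  simp only [sub_eq_add_neg _ θ]
  rw [periodicCoeff_add (by fun_prop) h3, periodicCoeff_sub h1 h2, periodicCoeff_const_mul,
    periodicCoeff_shift hp, periodicCoeff_shift hp]
  ring

theorem wffSymbol_mul_periodicCoeff {a b c θ : ℝ} {C : ℂ} {p p' p'' g : ℝ → ℂ}
    (hp : ∀ z, HasDerivAt p (p' z) z) (hp' : ∀ z, HasDerivAt p' (p'' z) z)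
    (hp'' : Continuous p'') (hg : Continuous g) (hper : Function.Periodic p (2 * Real.pi))
    (heq : ∀ z, p'' z + a * p' z + b * g z = C + c * (p (z + θ) - 2 * p z + p (z - θ)))
    {k : ℤ} (hk : k ≠ 0) :
    wffSymbol a c θ k * periodicCoeff p k = -b * periodicCoeff g k := by
  have hpc : Continuous p := continuous_iff_continuousAt.2 fun z => (hp z).continuousAt
  have hpc' : Continuous p' := continuous_iff_continuousAt.2 fun z => (hp' z).continuousAt
  have h := congrArg (fun f => periodicCoeff f k) (funext heq)
  beta_reduce at h
  rw [periodicCoeff_add (by fun_prop) (by fun_prop), periodicCoeff_add (by fun_prop) (by fun_prop),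
    periodicCoeff_add (by fun_prop) (by fun_prop), periodicCoeff_const C hk,
    periodicCoeff_const_mul, periodicCoeff_const_mul, periodicCoeff_const_mul,
    periodicCoeff_shift_combination hpc hper,
    periodicCoeff_deriv hp' hp'' (periodic_of_hasDerivAt hp hper), periodicCoeff_deriv hp hpc' hper]
    at h
  rw [wffSymbol]
  linear_combination h

theorem exists_hasDerivAt_of_wffSymbol_mul_periodicCoeff {a b c θ : ℝ} {u g : ℝ → ℂ}
    (hu : Continuous u) (hg : Continuous g) (hup : Function.Periodic u (2 * Real.pi))
    (hgp : Function.Periodic g (2 * Real.pi)) (hu0 : periodicCoeff u 0 = 0)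
    (heq : ∀ k : ℤ, k ≠ 0 → wffSymbol a c θ k * periodicCoeff u k = -b * periodicCoeff g k) :
    ∃ u' : ℝ → ℂ, (∀ z, HasDerivAt u (u' z) z) ∧
      ∀ z, HasDerivAt u' (b * ((2 * Real.pi : ℂ)⁻¹ * periodicCoeff g 0 - g z)
        + c * (u (z + θ) - 2 * u z + u (z - θ)) - a * u' z) z := by
  have hpi : (Real.pi : ℂ) ≠ 0 := by exact_mod_cast Real.pi_ne_zero
  have hconst (C : ℂ) : periodicCoeff (fun _ => C) 0 = 2 * Real.pi * C := by
    simp [periodicCoeff_zero_right]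
  refine hasDerivAt_of_periodicCoeff hu (by fun_prop) hup (fun z => ?_) hu0 fun k => ?_
  · have h1 := hup (z + θ)
    have h2 := hup (z - θ)
    rw [add_right_comm] at h1
    rw [sub_add_eq_add_sub] at h2
    simp only [hgp z, hup z, h1, h2]
  rw [periodicCoeff_add (by fun_prop) (by fun_prop), periodicCoeff_const_mul,
    periodicCoeff_sub (by fun_prop) hg, periodicCoeff_const_mul (c : ℂ),
    periodicCoeff_shift_combination hu hup]
  rcases eq_or_ne k 0 with rfl | hk
  · rw [hu0, hconst]
    field_simp
    simp
  · rw [periodicCoeff_const _ hk]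
    have h := heq k hk
    rw [wffSymbol] at h
    linear_combination h

end WffSymbol

section WffSolution

open Complex
open scoped NNReal

theorem existsUnique_periodic_periodicCoeff_eq {m : ℤ → ℂ} {q : ℝ≥0} (hq : q < 1)
    (hm : ∀ k, ‖m k‖ ≤ q) (hs : Summable fun k => ‖m k‖) :
    ∃! u : ℝ → ℂ, Continuous u ∧ Function.Periodic u (2 * Real.pi) ∧
      ∀ k, periodicCoeff u k
        = m k * periodicCoeff (fun t => (Real.sin (t + (u t).re) : ℂ)) k := by
  have : Fact (0 < 2 * Real.pi) := ⟨Real.two_pi_pos⟩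
  have hpi : (2 * Real.pi : ℂ) ≠ 0 := by exact_mod_cast Real.two_pi_pos.ne'
  let G (z : Real.Angle) (x : ℂ) : ℂ := (Real.Angle.sin (z + (x.re : Real.Angle)) : ℂ)
  have hGt (t : ℝ) (x : ℂ) : G t x = (Real.sin (t + x.re) : ℂ) := rfl
  have hG : Continuous (Function.uncurry G) := by
    refine continuous_ofReal.comp (Real.Angle.continuous_sin.comp ?_)
    exact continuous_fst.add (Real.Angle.continuous_coe.comp (continuous_re.comp continuous_snd))
  have hL (z : Real.Angle) (x y : ℂ) : ‖G z x - G z y‖ ≤ ‖x - y‖ := by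
    induction z using Real.Angle.induction_on with | _ t
    rw [hGt, hGt, ← ofReal_sub, norm_real, Real.norm_eq_abs]
    refine (Real.abs_sin_sub_sin_le _ _).trans ?_
    rw [add_sub_add_left_eq_sub, ← sub_re]
    exact abs_re_le_norm _
  have hiff (F : C(AddCircle (2 * Real.pi), ℂ)) (k : ℤ) :
      fourierCoeff F k = m k * fourierCoeff (fun z => G z (F z)) k ↔
        periodicCoeff (fun t : ℝ => F t) k
          = m k * periodicCoeff (fun t => (Real.sin (t + (F t).re) : ℂ)) k := by
    rw [fourierCoeff_eq_periodicCoeff, fourierCoeff_eq_periodicCoeff, mul_left_comm,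
      mul_right_inj' (inv_ne_zero hpi)]
    rfl
  obtain ⟨F, hF, hF'⟩ := existsUnique_continuousMap_fourierCoeff_eq hq hm hs hG hL
  refine ⟨fun t => F t, ⟨F.continuous.comp (AddCircle.continuous_mk' _), fun t => ?_,
    fun k => (hiff F k).1 (hF k)⟩, fun w ⟨hwc, hwp, hw⟩ => ?_⟩
  · simp only [AddCircle.coe_add_period]
  · obtain ⟨W, hW⟩ := exists_continuousMap_eq hwc hwp
    have : W = F := hF' W fun k => (hiff W k).2 (by simpa only [hW] using hw k)
    ext t
    rw [← this, hW]

theorem wffSymbol_ne_zero {a : ℝ} (ha : 0 < a) (c θ : ℝ) {k : ℤ} (hk : k ≠ 0) :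
    wffSymbol a c θ k ≠ 0 :=
  norm_pos_iff.1 (ha.trans_le (le_norm_wffSymbol ha c θ hk))

theorem WffSolution.periodicCoeff_eq {n m : ℕ} {Γ K lam : ℝ} (ha : 0 < lam * Γ) {u : ℝ → ℝ}
    (h : WffSolution n m Γ K lam u) (k : ℤ) :
    periodicCoeff (fun t => (u t : ℂ)) k
      = -((lam ^ 2 : ℝ) : ℂ) / wffSymbol (lam * Γ) (lam ^ 2 * K) (2 * Real.pi * m / n) k
        * periodicCoeff (fun t => (Real.sin (t + u t) : ℂ)) k := by
  obtain ⟨hC, hp, h0, heq⟩ := h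
  rcases eq_or_ne k 0 with rfl | hk
  · rw [wffSymbol_zero, periodicCoeff_zero_right, intervalIntegral.integral_ofReal, h0]
    simp
  have hC1 : ContDiff ℝ 1 (deriv u) := ((contDiff_succ_iff_deriv (n := 1)).1 hC).2.2
  have hu := hC.continuous
  have hu2 : Continuous (deriv (deriv u)) := hC1.continuous_deriv le_rfl
  have h1 (z : ℝ) : HasDerivAt (fun t => (u t : ℂ)) ((deriv u z : ℝ) : ℂ) z :=
    ((hC.differentiable two_ne_zero) z).hasDerivAt.ofReal_comp
  have h2 (z : ℝ) : HasDerivAt (fun t => ((deriv u t : ℝ) : ℂ)) ((deriv (deriv u) z : ℝ) : ℂ) z :=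
    ((hC1.differentiable one_ne_zero) z).hasDerivAt.ofReal_comp
  have h3 := wffSymbol_mul_periodicCoeff (a := lam * Γ) (b := lam ^ 2) (c := lam ^ 2 * K)
    (θ := 2 * Real.pi * m / n) (g := fun t => (Real.sin (t + u t) : ℂ))
    (C := (lam ^ 2 * (1 / (2 * Real.pi)) *
      ∫ s in (0 : ℝ)..(2 * Real.pi), Real.sin (s + u s) : ℝ)) h1 h2
    (by fun_prop) (by fun_prop) (fun z => by simp only [hp z])
    (fun z => by exact_mod_cast congrArg ofReal (heq z)) hk
  rw [div_mul_eq_mul_div, eq_div_iff (wffSymbol_ne_zero ha _ _ hk), mul_comm, h3]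

theorem exists_wffSolution_of_periodicCoeff {n m : ℕ} {Γ K lam : ℝ} (ha : 0 < lam * Γ) {u : ℝ → ℂ}
    (hu : Continuous u) (hp : Function.Periodic u (2 * Real.pi))
    (h : ∀ k, periodicCoeff u k
      = -((lam ^ 2 : ℝ) : ℂ) / wffSymbol (lam * Γ) (lam ^ 2 * K) (2 * Real.pi * m / n) k
        * periodicCoeff (fun t => (Real.sin (t + (u t).re) : ℂ)) k) :
    WffSolution n m Γ K lam fun t => (u t).re := by
  have hu0 : periodicCoeff u 0 = 0 := by rw [h 0, wffSymbol_zero]; simp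
  obtain ⟨u', h1, h2⟩ := exists_hasDerivAt_of_wffSymbol_mul_periodicCoeff
    (a := lam * Γ) (b := lam ^ 2) (c := lam ^ 2 * K) (θ := 2 * Real.pi * m / n)
    (g := fun t => (Real.sin (t + (u t).re) : ℂ)) hu (by fun_prop) hp
    (fun z => by simp only [hp z, add_right_comm z, Real.sin_add_two_pi]) hu0
    (fun k hk => by
      rw [h k, div_mul_eq_mul_div, mul_div_cancel₀ _ (wffSymbol_ne_zero ha _ _ hk)])
  have hu' : Continuous u' := continuous_iff_continuousAt.2 fun z => (h2 z).continuousAt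
  have h1r (z : ℝ) : HasDerivAt (fun t => (u t).re) (u' z).re z :=
    reCLM.hasFDerivAt.comp_hasDerivAt z (h1 z)
  have h2r (z : ℝ) := reCLM.hasFDerivAt.comp_hasDerivAt z (h2 z)
  have hd1 : deriv (fun t => (u t).re) = fun t => (u' t).re := funext fun z => (h1r z).deriv
  have hd2 := funext fun z => (h2r z).deriv
  simp only [Function.comp_def, reCLM_apply] at hd2
  refine ⟨?_, fun z => by simp only [hp z], ?_, fun z => ?_⟩
  · refine (contDiff_succ_iff_deriv (n := 1)).2 ⟨fun z => (h1r z).differentiableAt, by simp, ?_⟩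
    rw [hd1]
    refine contDiff_one_iff_deriv.2 ⟨fun z => (h2r z).differentiableAt, ?_⟩
    rw [hd2]
    fun_prop
  · have hre := reCLM.intervalIntegral_comp_comm
      (hu.intervalIntegrable (μ := MeasureTheory.volume) 0 (2 * Real.pi))
    rw [← periodicCoeff_zero_right, hu0] at hre
    simpa using hre
  · rw [hd1, hd2, periodicCoeff_zero_right, intervalIntegral.integral_ofReal]
    have hC : (2 * Real.pi : ℂ)⁻¹ = ((2 * Real.pi)⁻¹ : ℝ) := by push_cast; rfl
    rw [hC]
    simp only [← ofReal_mul, ← ofReal_sub, sub_re, add_re, re_ofReal_mul, ofReal_re]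
    rw [show (2 * u z).re = 2 * (u z).re by simp]
    ring

end WffSolution

open Real in
/-- For every velocity `v > 1/Γ` there is exactly one solution `u` of (wff) with
parameter `λ = 1/v`; consequently there is exactly one force `F` (namely
`F = Γv + (1/2π)∫₀^{2π} sin(s+u(s)) ds`) for which the discrete sine-Gordon ring
has a travelling wave with velocity `v` whose profile `u` has zero mean on
`[0, 2π]`. -/
theorem existsUnique_wffSolution_of_large_velocity (n m : ℕ) (hn : 1 ≤ n)
    (hm : 1 ≤ m) (Γ K v : ℝ) (hΓ : 0 < Γ) (hK : 0 < K) (hv : 1 / Γ < v) :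
    (∃! u : ℝ → ℝ, WffSolution n m Γ K (1 / v) u) ∧
    (∃! F : ℝ, ∃ u : ℝ → ℝ, WffSolution n m Γ K (1 / v) u ∧
      F = Γ * v + (1 / (2 * π)) * ∫ s in (0:ℝ)..(2 * π), Real.sin (s + u s)) := by
  have hv0 : 0 < v := (one_div_pos.2 hΓ).trans hv
  have hlam : 0 < 1 / v := one_div_pos.2 hv0
  have ha : 0 < 1 / v * Γ := mul_pos hlam hΓ
  have hb : 0 ≤ (1 / v) ^ 2 := sq_nonneg _
  have hc : 0 ≤ (1 / v) ^ 2 * K := mul_nonneg hb hK.le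
  have hq : (1 / v) ^ 2 / (1 / v * Γ) < 1 := by
    rw [div_lt_one ha, sq]
    gcongr
    rwa [one_div_lt hv0 hΓ]
  obtain ⟨w, ⟨hwc, hwp, hw⟩, hw'⟩ := existsUnique_periodic_periodicCoeff_eq
    (q := ⟨(1 / v) ^ 2 / (1 / v * Γ), div_nonneg hb ha.le⟩) hq
    (norm_div_wffSymbol_le ha hb ((1 / v) ^ 2 * K) (2 * π * m / n))
    (summable_norm_div_wffSymbol ha hb hc (2 * π * m / n))
  have huniq (u : ℝ → ℝ) (hu : WffSolution n m Γ K (1 / v) u) : u = fun t => (w t).re := by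
    have h := hw' (fun t => (u t : ℂ)) ⟨Complex.continuous_ofReal.comp hu.1.continuous,
      fun t => by simp only [hu.2.1 t], fun k => by simpa using hu.periodicCoeff_eq ha k⟩
    rw [← h]
    simp
  have hsol := exists_wffSolution_of_periodicCoeff ha hwc hwp hw
  refine ⟨⟨_, hsol, huniq⟩, ⟨_, ⟨_, hsol, rfl⟩, ?_⟩⟩
  rintro F ⟨u, hu, rfl⟩
  rw [huniq u hu]
end

section
/- Let q ≥ 2 be an integer and let u₀ : ℝ → ℝ be a continuous function that is 2π/q-periodic, i.e., u₀(s + 2π/q) = u₀(s) for all s ∈ ℝ. Then ∫₀^{2π} sin(s + u₀(s)) ds = 0. -/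
open Real in
/-- If `q ≥ 2` is an integer and `u₀ : ℝ → ℝ` is continuous and `2π/q`-periodic,
then `∫₀^{2π} sin(s + u₀(s)) ds = 0`. -/
theorem integral_sin_add_periodic_eq_zero (q : ℕ) (hq : 2 ≤ q)
    (u₀ : ℝ → ℝ) (hcont : Continuous u₀)
    (hper : ∀ s : ℝ, u₀ (s + 2 * π / q) = u₀ s) :
    (∫ s in (0:ℝ)..(2 * π), Real.sin (s + u₀ s)) = 0 := by
  have hq2 : (2 : ℝ) ≤ q := by exact_mod_cast hq
  have hq0 : (q : ℝ) ≠ 0 := by positivity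
  have hu : Function.Periodic u₀ (2 * π) := by
    have h := Function.Periodic.nat_mul (f := u₀) hper q
    rwa [mul_div_cancel₀ _ hq0] at h
  have hcos : cos (2 * π / q) < 1 := by
    rw [← cos_zero]
    refine cos_lt_cos_of_nonneg_of_le_pi le_rfl ?_ (by positivity)
    rw [div_le_iff₀ (by positivity)]
    nlinarith [pi_pos]
  have shift (f : ℝ → ℝ) (hf : Function.Periodic f (2 * π)) :
      ∫ s in (0:ℝ)..(2 * π), f (s + 2 * π / q) = ∫ s in (0:ℝ)..(2 * π), f s := by
    rw [intervalIntegral.integral_comp_add_right]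
    simpa [add_comm] using hf.intervalIntegral_add_eq (2 * π / q) 0
  have hI := shift (fun s ↦ sin (s + u₀ s)) fun s ↦ by
    simp only [hu s, add_right_comm s, sin_add_two_pi]
  have hJ := shift (fun s ↦ cos (s + u₀ s)) fun s ↦ by
    simp only [hu s, add_right_comm s, cos_add_two_pi]
  have intS (c : ℝ) : IntervalIntegrable (fun s ↦ sin (s + u₀ s) * c)
      MeasureTheory.volume 0 (2 * π) :=
    Continuous.intervalIntegrable (by fun_prop) _ _
  have intC (c : ℝ) : IntervalIntegrable (fun s ↦ cos (s + u₀ s) * c)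
      MeasureTheory.volume 0 (2 * π) :=
    Continuous.intervalIntegrable (by fun_prop) _ _
  simp only [hper, add_right_comm _ (2 * π / (q : ℝ)), sin_add _ (2 * π / (q : ℝ))] at hI
  simp only [hper, add_right_comm _ (2 * π / (q : ℝ)), cos_add _ (2 * π / (q : ℝ))] at hJ
  rw [intervalIntegral.integral_add (intS _) (intC _), intervalIntegral.integral_mul_const,
    intervalIntegral.integral_mul_const] at hI
  rw [intervalIntegral.integral_sub (intC _) (intS _), intervalIntegral.integral_mul_const,
    intervalIntegral.integral_mul_const] at hJ
  set I := ∫ s in (0:ℝ)..(2 * π), sin (s + u₀ s)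
  have key : 2 * (1 - cos (2 * π / q)) * I = 0 := by
    linear_combination (cos (2 * π / q) - 1) * hI - sin (2 * π / q) * hJ
      - I * sin_sq_add_cos_sq (2 * π / q)
  exact (mul_eq_zero.mp key).resolve_left (by linarith)
end
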